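/- arXiv:1701.06800 — 2 statements merged into one kernel-verified Lean document; each statement's English description precedes it below -/
import Mathlib

section
/- For the class of directed rooted chains (directed paths) on n nodes, the dissemination time is at most n-1 rounds: after n-1 rounds of arbitrary directed path communication graphs, some process p satisfies S_p(n-1) = Π. -/
/-- Influence sets: `influence G p r` is the set of processes that know
about `p` at the end of round `r`, where `G r` is the round-`r`
communication graph (edges `G r q q'` mean `q` sends to `q'`). -/
def influence {n : ℕ} (G : ℕ → Fin n → Fin n → Prop) (p : Fin n) : ℕ → Set (Fin n)
  | 0 => {p}
  | r + 1 => influence G p r ∪ {q' | ∃ q ∈ influence G p r, G (r + 1) q q'}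

/-- `E` is a directed tree on `Fin n` rooted at `root`, edges oriented away
from the root: every node is reachable from the root, every non-root node
has a unique parent, and the root has no parent. -/
def IsRootedTree {n : ℕ} (E : Fin n → Fin n → Prop) (root : Fin n) : Prop :=
  (∀ v, Relation.ReflTransGen E root v) ∧
  (∀ v, v ≠ root → ∃! u, E u v) ∧
  (∀ u, ¬ E u root)

/-- A leaf of a directed graph: a node with no outgoing edge. -/
def IsLeaf {n : ℕ} (E : Fin n → Fin n → Prop) (v : Fin n) : Prop := ∀ w, ¬ E v w

/-- The successor relation of the chain `σ 0 → σ 1 → ⋯ → σ (n-1)`. -/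
def chainEdge {n : ℕ} (σ : Fin n ≃ Fin n) (u v : Fin n) : Prop :=
  ∃ i j : Fin n, (j : ℕ) = (i : ℕ) + 1 ∧ u = σ i ∧ v = σ j

/-- `E` is a directed chain (rooted path) on all `n` nodes. -/
def IsDirChain {n : ℕ} (E : Fin n → Fin n → Prop) : Prop :=
  ∃ σ : Fin n ≃ Fin n, ∀ u v, E u v ↔ chainEdge σ u v

/-- `E` is an undirected path on all `n` nodes (messages traverse edges in
both directions). -/
def IsUndirPath {n : ℕ} (E : Fin n → Fin n → Prop) : Prop :=
  ∃ σ : Fin n ≃ Fin n, ∀ u v, E u v ↔ (chainEdge σ u v ∨ chainEdge σ v u)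

/-- The influence sets indexed by `I` cover `Π` at time `r`. -/
def isCovering {n : ℕ} (G : ℕ → Fin n → Fin n → Prop) (I : Set (Fin n)) (r : ℕ) : Prop :=
  ⋃ p ∈ I, influence G p r = Set.univ

/-- A strict covering: no member can be removed. -/
def isStrictCovering {n : ℕ} (G : ℕ → Fin n → Fin n → Prop) (I : Set (Fin n)) (r : ℕ) : Prop :=
  isCovering G I r ∧ ∀ p ∈ I, ¬ isCovering G (I \ {p}) r

open Classical in
/-- Nodes reached at time `r` from some member of `B`. -/
noncomputable def reachU {n : ℕ} (G : ℕ → Fin n → Fin n → Prop) (r : ℕ) (B : Finset (Fin n)) :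
    Finset (Fin n) :=
  Finset.univ.filter (fun q => ∃ p ∈ B, q ∈ influence G p r)

theorem mem_reachU {n : ℕ} (G : ℕ → Fin n → Fin n → Prop) (r : ℕ) (B : Finset (Fin n))
    (q : Fin n) : q ∈ reachU G r B ↔ ∃ p ∈ B, q ∈ influence G p r := by
  simp [reachU]

theorem reachU_mono {n : ℕ} (G : ℕ → Fin n → Fin n → Prop) (r : ℕ) (B : Finset (Fin n)) :
    reachU G r B ⊆ reachU G (r + 1) B := by
  intro q hq
  rw [mem_reachU] at hq ⊢
  obtain ⟨p, hp, h⟩ := hq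
  exact ⟨p, hp, Or.inl h⟩

theorem reachU_closed {n : ℕ} (G : ℕ → Fin n → Fin n → Prop) (r : ℕ) (B : Finset (Fin n))
    (h : (reachU G (r + 1) B).card ≤ (reachU G r B).card) (u v : Fin n)
    (hu : u ∈ reachU G r B) (huv : G (r + 1) u v) : v ∈ reachU G r B := by
  rw [Finset.eq_of_subset_of_card_le (reachU_mono G r B) h]
  rw [mem_reachU] at hu ⊢
  obtain ⟨p, hp, h⟩ := hu
  exact ⟨p, hp, Or.inr ⟨u, h, huv⟩⟩

theorem closed_up {n : ℕ} (E : Fin n → Fin n → Prop) (σ : Fin n ≃ Fin n)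
    (hσ : ∀ u v, E u v ↔ chainEdge σ u v) (A : Finset (Fin n))
    (hA : ∀ u v, u ∈ A → E u v → v ∈ A) (i : Fin n) (hi : σ i ∈ A) :
    ∀ (k : ℕ) (hk : i.val + k < n), σ ⟨i.val + k, hk⟩ ∈ A := by
  intro k
  induction k with
  | zero => intro hk; exact hi
  | succ k ih =>
    intro hk
    have h1 : i.val + k < n := by omega
    exact hA _ _ (ih h1) ((hσ _ _).2 ⟨⟨i.val + k, h1⟩, ⟨i.val + (k + 1), hk⟩, rfl, rfl, rfl⟩)

theorem closed_nested {n : ℕ} (E : Fin n → Fin n → Prop) (hE : IsDirChain E)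
    (A B : Finset (Fin n)) (hA : ∀ u v, u ∈ A → E u v → v ∈ A)
    (hB : ∀ u v, u ∈ B → E u v → v ∈ B) (hc : A.card ≤ B.card) : A ⊆ B := by
  obtain ⟨σ, hσ⟩ := hE
  by_contra hn
  obtain ⟨x, hxA, hxB⟩ := Finset.not_subset.1 hn
  have hsub : B ⊆ A := by
    intro y hy
    obtain ⟨i, rfl⟩ := σ.surjective x
    obtain ⟨j, rfl⟩ := σ.surjective y
    rcases le_total i.val j.val with h | h
    · have := closed_up E σ hσ A hA i hxA (j.val - i.val) (by omega)
      convert this using 2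
      ext
      simp
      omega
    · exfalso
      apply hxB
      have := closed_up E σ hσ B hB j hy (i.val - j.val) (by omega)
      convert this using 2
      ext
      simp
      omega
  have := Finset.eq_of_subset_of_card_le hsub hc
  exact hxB (this ▸ hxA)

/-- Key invariant (a truncated partition inequality). -/
theorem key_invariant {n : ℕ} (G : ℕ → Fin n → Fin n → Prop)
    (hchain : ∀ r, 1 ≤ r → IsDirChain (G r)) (r : ℕ) :
    ∀ P : Finset (Finset (Fin n)), (∀ p : Fin n, ∃ B ∈ P, p ∈ B) →
      n - r ≤ ∑ B ∈ P, ((reachU G r B).card - r) := by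
  classical
  induction r with
  | zero =>
    intro P hP
    have h0 : ∀ B : Finset (Fin n), reachU G 0 B = B := by
      intro B; ext q; rw [mem_reachU]; simp [influence]
    simp only [h0, Nat.sub_zero]
    have h1 : P.biUnion id = Finset.univ := by
      ext p; simpa using hP p
    have h2 := Finset.card_biUnion_le (s := P) (t := id)
    rw [h1] at h2
    simpa using h2
  | succ r ih =>
    intro P hP
    have hmono : ∀ B, (reachU G r B).card ≤ (reachU G (r + 1) B).card :=
      fun B => Finset.card_le_card (reachU_mono G r B)
    let st : Finset (Fin n) → Prop := fun B => (reachU G (r + 1) B).card ≤ (reachU G r B).card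
    have hns : ∀ B, ¬ st B →
        (reachU G r B).card - r ≤ (reachU G (r + 1) B).card - (r + 1) := by
      intro B hB
      have : ¬ ((reachU G (r + 1) B).card ≤ (reachU G r B).card) := hB
      omega
    have hsplit : ∑ B ∈ P.filter st, ((reachU G (r + 1) B).card - (r + 1)) +
        ∑ B ∈ P.filter (fun B => ¬ st B), ((reachU G (r + 1) B).card - (r + 1)) =
        ∑ B ∈ P, ((reachU G (r + 1) B).card - (r + 1)) := by
      convert Finset.sum_filter_add_sum_filter_not P st
        (fun B => (reachU G (r + 1) B).card - (r + 1))
    have hnot : ∑ B ∈ P.filter (fun B => ¬ st B), ((reachU G r B).card - r) ≤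
        ∑ B ∈ P.filter (fun B => ¬ st B), ((reachU G (r + 1) B).card - (r + 1)) :=
      Finset.sum_le_sum (fun B hB => hns B (Finset.mem_filter.1 hB).2)
    rcases (P.filter st).eq_empty_or_nonempty with he | hne
    · have h1 : P.filter (fun B => ¬ st B) = P := by
        apply Finset.filter_true_of_mem
        intro B hB hs
        have : B ∈ P.filter st := Finset.mem_filter.2 ⟨hB, hs⟩
        rw [he] at this
        simp at this
      rw [h1] at hnot
      have := ih P hP
      omega
    · obtain ⟨B0, hB0, hmax⟩ := Finset.exists_max_image (P.filter st)
        (fun B => (reachU G r B).card) hne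
      let M : Finset (Fin n) := (P.filter st).biUnion id
      have hM : reachU G r M ⊆ reachU G r B0 := by
        intro q hq
        obtain ⟨p, hp, hpq⟩ := (mem_reachU _ _ _ _).1 hq
        obtain ⟨B, hB, hpB⟩ := Finset.mem_biUnion.1 hp
        have hsub : reachU G r B ⊆ reachU G r B0 :=
          closed_nested (G (r + 1)) (hchain _ (by omega)) _ _
            (reachU_closed G r B (Finset.mem_filter.1 hB).2)
            (reachU_closed G r B0 (Finset.mem_filter.1 hB0).2) (hmax B hB)
        exact hsub ((mem_reachU _ _ _ _).2 ⟨p, hpB, hpq⟩)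
      have hMc := Finset.card_le_card hM
      have h1 := ih (insert M (P.filter (fun B => ¬ st B))) (by
        intro p
        obtain ⟨B, hB, hpB⟩ := hP p
        by_cases hs : st B
        · exact ⟨M, Finset.mem_insert_self _ _,
            Finset.mem_biUnion.2 ⟨B, Finset.mem_filter.2 ⟨hB, hs⟩, hpB⟩⟩
        · exact ⟨B, Finset.mem_insert_of_mem (Finset.mem_filter.2 ⟨hB, hs⟩), hpB⟩)
      have h2 : ∑ B ∈ insert M (P.filter (fun B => ¬ st B)), ((reachU G r B).card - r) ≤
          ((reachU G r M).card - r) +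
            ∑ B ∈ P.filter (fun B => ¬ st B), ((reachU G r B).card - r) := by
        by_cases hm : M ∈ P.filter (fun B => ¬ st B)
        · rw [Finset.insert_eq_of_mem hm]; omega
        · rw [Finset.sum_insert hm]
      have h3 : (reachU G (r + 1) B0).card - (r + 1) ≤
          ∑ B ∈ P.filter st, ((reachU G (r + 1) B).card - (r + 1)) :=
        Finset.single_le_sum (f := fun B => (reachU G (r + 1) B).card - (r + 1))
          (fun _ _ => Nat.zero_le _) hB0
      have h4 := hmono B0
      omega

/-- for directed rooted chains on `n ≥ 1` nodes, dissemination
completes within `n - 1` rounds. -/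
theorem dissemination_directed_chains {n : ℕ} (hn : 1 ≤ n)
    (G : ℕ → Fin n → Fin n → Prop)
    (hchain : ∀ r, 1 ≤ r → IsDirChain (G r)) :
    ∃ p : Fin n, influence G p (n - 1) = Set.univ := by
  classical
  have h := key_invariant G hchain (n - 1)
    (Finset.univ.image (fun p : Fin n => ({p} : Finset (Fin n))))
    (fun p => ⟨{p}, by simp, by simp⟩)
  have hpos : 0 < ∑ B ∈ Finset.univ.image (fun p : Fin n => ({p} : Finset (Fin n))),
      ((reachU G (n - 1) B).card - (n - 1)) := by omega
  obtain ⟨B, hB, hlt⟩ : ∃ B ∈ Finset.univ.image (fun p : Fin n => ({p} : Finset (Fin n))),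
      0 < (reachU G (n - 1) B).card - (n - 1) := by
    by_contra! hc
    have := Finset.sum_nonpos hc
    omega
  obtain ⟨p, -, rfl⟩ := Finset.mem_image.1 hB
  refine ⟨p, ?_⟩
  have hu : reachU G (n - 1) {p} = Finset.univ := by
    apply Finset.eq_univ_of_card
    have := Finset.card_le_univ (reachU G (n - 1) {p})
    rw [Fintype.card_fin] at *
    omega
  ext q
  have : q ∈ reachU G (n - 1) {p} := by rw [hu]; exact Finset.mem_univ q
  rw [mem_reachU] at this
  simpa using this
end

section
/- For the class of undirected chains (paths) on n nodes, the dissemination time is at most ⌈(n−1)/2⌉ rounds: after ⌈(n−1)/2⌉ rounds of arbitrary undirected path communication graphs, some process p satisfies S_p(r) = Π. -/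
lemma duc_crossUp (P : ℕ → Prop) (i j : ℕ) (hij : i < j) (hi : ¬ P i) (hj : P j) :
    ∃ c, i ≤ c ∧ c < j ∧ ¬ P c ∧ P (c + 1) := by
  induction j, hij using Nat.le_induction with
  | base => exact ⟨i, le_rfl, Nat.lt_succ_self i, hi, hj⟩
  | succ k hk ih =>
    by_cases h : P k
    · obtain ⟨c, h1, h2, h3, h4⟩ := ih h
      exact ⟨c, h1, by omega, h3, h4⟩
    · exact ⟨k, by omega, by omega, h, hj⟩

lemma duc_crossDown (P : ℕ → Prop) (i j : ℕ) (hij : i < j) (hi : P i) (hj : ¬ P j) :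
    ∃ c, i ≤ c ∧ c < j ∧ P c ∧ ¬ P (c + 1) := by
  obtain ⟨c, h1, h2, h3, h4⟩ := duc_crossUp (fun k => ¬ P k) i j hij (by simpa using hi) hj
  exact ⟨c, h1, h2, by simpa using h3, h4⟩

lemma duc_nat (n : ℕ) (P : ℕ → Prop) (a b : ℕ) (hab : a < b) (hb : b < n)
    (hPa : ¬ P a) (hPb : ¬ P b)
    (hN : ∀ c d, c < n → d < n → ¬ P c → ¬ P d →
      (P (c + 1) ∧ c + 1 < n ∨ ∃ e, e + 1 = c ∧ P e) →
      (P (d + 1) ∧ d + 1 < n ∨ ∃ e, e + 1 = d ∧ P e) → c = d) :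
    (∀ x y, x < n → y < n → P x → ¬ P y → x < y) ∨
    (∀ x y, x < n → y < n → P x → ¬ P y → y < x) := by
  have conv : ∀ i x j, i < x → x < j → j < n → ¬ P i → ¬ P j → ¬ P x := by
    intro i x j h1 h2 h3 hi hj hx
    obtain ⟨c, c1, c2, c3, c4⟩ := duc_crossUp P i x h1 hi hx
    obtain ⟨d, d1, d2, d3, d4⟩ := duc_crossDown P x j h2 hx hj
    have := hN c (d+1) (by omega) (by omega) c3 d4 (Or.inl ⟨c4, by omega⟩) (Or.inr ⟨d, rfl, d3⟩)
    omega
  by_contra hcon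
  push Not at hcon
  obtain ⟨⟨y, j, hy, hj, hPy, hPj, hjy⟩, ⟨x, i, hx, hi, hPx, hPi, hxi⟩⟩ := hcon
  have hne1 : j ≠ y := by rintro rfl; exact hPj hPy
  have hne2 : i ≠ x := by rintro rfl; exact hPi hPx
  -- every non-member lies strictly between `x` and `y`
  have btw : ∀ k, k < n → ¬ P k → x < k ∧ k < y := by
    intro k hk hPk
    have e1 : k ≠ x := by rintro rfl; exact hPk hPx
    have e2 : k ≠ y := by rintro rfl; exact hPk hPy
    constructor
    · by_contra h
      exact conv k x i (by omega) (by omega) hi hPk hPi hPx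
    · by_contra h
      exact conv j y k (by omega) (by omega) hk hPj hPk hPy
  obtain ⟨d, d1, d2, d3, d4⟩ := duc_crossDown P x a (btw a (by omega) hPa).1 hPx hPa
  obtain ⟨c, c1, c2, c3, c4⟩ := duc_crossUp P b y (btw b hb hPb).2 hPb hPy
  have := hN c (d+1) (by omega) (by omega) c3 d4 (Or.inl ⟨c4, by omega⟩) (Or.inr ⟨d, rfl, d3⟩)
  omega

section duc
variable {n : ℕ} (pos : Fin n ≃ Fin n)

/-- adjacency on the path described by positions -/
def ducAdj (u v : Fin n) : Prop :=
  (pos u : ℕ) + 1 = pos v ∨ (pos v : ℕ) + 1 = pos u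

/-- prefix of the path -/
def ducPre (S : Finset (Fin n)) : Prop := ∀ x ∈ S, ∀ a, a ∉ S → (pos x : ℕ) < pos a
/-- suffix of the path -/
def ducSuf (S : Finset (Fin n)) : Prop := ∀ x ∈ S, ∀ a, a ∉ S → (pos a : ℕ) < pos x

lemma duc_closed (S : Finset (Fin n)) (hne : S.Nonempty)
    (hcl : ∀ u ∈ S, ∀ v, ducAdj pos u v → v ∈ S) : S = Finset.univ := by
  obtain ⟨x, hx⟩ := hne
  ext a
  simp only [Finset.mem_univ, iff_true]
  by_contra ha
  have hpx : ∃ v ∈ S, (pos v : ℕ) = pos x := ⟨x, hx, rfl⟩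
  have hpa : ¬ ∃ v ∈ S, (pos v : ℕ) = pos a := by
    rintro ⟨v, hv, h⟩
    exact ha (pos.injective (Fin.ext h) ▸ hv)
  rcases lt_trichotomy (pos x : ℕ) (pos a) with h | h | h
  · obtain ⟨c, c1, c2, ⟨v, hv, c3⟩, c4⟩ :=
      duc_crossDown (fun i => ∃ v ∈ S, (pos v : ℕ) = i) _ _ h hpx hpa
    have hlt : c + 1 < n := lt_of_le_of_lt c2 (pos a).2
    refine c4 ⟨pos.symm ⟨c+1, hlt⟩, hcl v hv _ (Or.inl ?_), ?_⟩ <;> simp [c3]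
  · exact hpa ⟨x, hx, h⟩
  · obtain ⟨c, c1, c2, c3, ⟨v, hv, c4⟩⟩ :=
      duc_crossUp (fun i => ∃ v ∈ S, (pos v : ℕ) = i) _ _ h hpa hpx
    have hlt : c < n := lt_trans c2 (pos x).2
    refine c3 ⟨pos.symm ⟨c, hlt⟩, hcl v hv _ (Or.inr ?_), ?_⟩ <;> simp [c4]

lemma duc_growth (S D : Finset (Fin n))
    (hD : ∀ v, v ∈ D ↔ v ∈ S ∨ ∃ u ∈ S, ducAdj pos u v)
    (hc : D.card ≤ S.card + 1) (hn : S.card + 2 ≤ n) : ducPre pos S ∨ ducSuf pos S := by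
  classical
  have hcard : 1 < (Sᶜ).card := by
    rw [Finset.card_compl, Fintype.card_fin]; omega
  obtain ⟨a, ha, b, hb, hab⟩ := Finset.one_lt_card.1 hcard
  rw [Finset.mem_compl] at ha hb
  let P : ℕ → Prop := fun i => ∃ v ∈ S, (pos v : ℕ) = i
  have hP : ∀ v, P (pos v) ↔ v ∈ S := by
    intro v
    constructor
    · rintro ⟨w, hw, h⟩
      exact pos.injective (Fin.ext h) ▸ hw
    · intro h; exact ⟨v, h, rfl⟩
  have hmem : ∀ c (hcn : c < n), (P (c + 1) ∧ c + 1 < n ∨ ∃ e, e + 1 = c ∧ P e) →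
      pos.symm ⟨c, hcn⟩ ∈ D := by
    intro c hcn h
    rw [hD]; right
    rcases h with ⟨⟨v, hv, h⟩, _⟩ | ⟨e, he, ⟨v, hv, h⟩⟩
    · exact ⟨v, hv, Or.inr (by simp [h])⟩
    · exact ⟨v, hv, Or.inl (by simp [h, he])⟩
  have hN : ∀ c d, c < n → d < n → ¬ P c → ¬ P d →
      (P (c + 1) ∧ c + 1 < n ∨ ∃ e, e + 1 = c ∧ P e) →
      (P (d + 1) ∧ d + 1 < n ∨ ∃ e, e + 1 = d ∧ P e) → c = d := by
    intro c d hcn hdn hPc hPd h1 h2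
    by_contra hne
    have m1 := hmem c hcn h1
    have m2 := hmem d hdn h2
    have n1 : pos.symm ⟨c, hcn⟩ ∉ S := by rw [← hP]; simpa using hPc
    have n2 : pos.symm ⟨d, hdn⟩ ∉ S := by rw [← hP]; simpa using hPd
    have hsub : insert (pos.symm ⟨c, hcn⟩) (insert (pos.symm ⟨d, hdn⟩) S) ⊆ D := by
      intro v hv
      simp only [Finset.mem_insert] at hv
      rcases hv with rfl | rfl | hv
      · exact m1
      · exact m2
      · exact (hD v).2 (Or.inl hv)
    have := Finset.card_le_card hsub
    rw [Finset.card_insert_of_notMem, Finset.card_insert_of_notMem n2] at this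
    · omega
    · simp [n1, hne]
  have key : (∀ x y, x < n → y < n → P x → ¬ P y → x < y) ∨
      (∀ x y, x < n → y < n → P x → ¬ P y → y < x) := by
    have hab' : (pos a : ℕ) ≠ pos b := fun h => hab (pos.injective (Fin.ext h))
    rw [← hP] at ha hb
    rcases lt_or_gt_of_ne hab' with h | h
    · exact duc_nat n P _ _ h (pos b).2 ha hb hN
    · exact duc_nat n P _ _ h (pos a).2 hb ha hN
  rcases key with h | h
  · left; intro x hx a ha
    exact h _ _ (pos x).2 (pos a).2 ((hP x).2 hx) (by rwa [hP])
  · right; intro x hx a ha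
    exact h _ _ (pos x).2 (pos a).2 ((hP x).2 hx) (by rwa [hP])

lemma duc_card_lt (k : ℕ) : (Finset.univ.filter fun v => (pos v : ℕ) < k).card ≤ k := by
  have : (Finset.univ.filter fun v => (pos v : ℕ) < k).card ≤ (Finset.range k).card := by
    apply Finset.card_le_card_of_injOn (fun v => (pos v : ℕ))
    · intro v hv; simpa using hv
    · intro u _ v _ h; exact pos.injective (Fin.ext h)
  simpa using this

lemma duc_card_gt (k : ℕ) : (Finset.univ.filter fun v => n - 1 - (pos v : ℕ) < k).card ≤ k := by
  have := duc_card_lt (pos.trans Fin.revPerm) k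
  refine le_trans (Finset.card_le_card ?_) this
  intro v hv
  simp [Fin.val_rev] at hv ⊢
  omega

lemma duc_pre_lt (S : Finset (Fin n)) (h : ducPre pos S) (x) (hx : x ∈ S) :
    (pos x : ℕ) < S.card := by
  have : (Finset.range ((pos x : ℕ) + 1)).card ≤ S.card := by
    apply Finset.card_le_card_of_surjOn (fun v => (pos v : ℕ))
    intro i hi
    have hi' : i < (pos x : ℕ) + 1 := by simpa using hi
    have hin : i < n := lt_of_le_of_lt (Nat.lt_succ_iff.1 hi') (pos x).2
    refine ⟨pos.symm ⟨i, hin⟩, ?_, by simp⟩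
    by_contra hc
    have := h x hx _ hc
    simp at this
    omega
  simpa using this

lemma duc_suf_lt (S : Finset (Fin n)) (h : ducSuf pos S) (x) (hx : x ∈ S) :
    n - 1 - (pos x : ℕ) < S.card := by
  have := duc_pre_lt (pos.trans Fin.revPerm) S (by
    intro x hx a ha
    have := h x hx a ha
    simp [Fin.val_rev]
    omega) x hx
  simp [Fin.val_rev] at this
  omega

/-- The counting invariant. -/
def ducInv (S : Fin n → Finset (Fin n)) (r : ℕ) : Prop :=
  ∀ (ι : Type) [Fintype ι] (X : ι → Finset (Fin n)) (B : Finset (Fin n)),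
    (∀ p ∈ B, (S p).card ≤ 2 * r ∨ ∃ i, S p ⊆ X i) →
    B.card ≤ 2 * r + ∑ i, ((X i).card - 2 * r)

lemma duc_step (S S' : Fin n → Finset (Fin n)) (r : ℕ)
    (hne : ∀ p, (S p).Nonempty)
    (hS' : ∀ p v, v ∈ S' p ↔ v ∈ S p ∨ ∃ u ∈ S p, ducAdj pos u v)
    (ih : ducInv S r) : ducInv S' (r + 1) := by
  classical
  intro ι _ X B hB
  have hBn : B.card ≤ n := by simpa using Finset.card_le_univ B
  by_cases hn : n ≤ 2 * (r + 1)
  · omega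
  push Not at hn
  by_cases hU : ∃ i, X i = Finset.univ
  · obtain ⟨i, hi⟩ := hU
    have := Finset.single_le_sum (f := fun i => (X i).card - 2 * (r + 1))
      (fun _ _ => Nat.zero_le _) (Finset.mem_univ i)
    simp only [hi, Finset.card_univ, Fintype.card_fin] at this
    omega
  push Not at hU
  -- erosion
  let e : Finset (Fin n) → Finset (Fin n) := fun Y =>
    Finset.univ.filter fun v => v ∈ Y ∧ ∀ u, ducAdj pos u v → u ∈ Y
  have hsymm : ∀ u v, ducAdj pos u v → ducAdj pos v u := fun u v h => h.symm
  have he : ∀ p Y, S' p ⊆ Y → S p ⊆ e Y := by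
    intro p Y h v hv
    simp only [e, Finset.mem_filter, Finset.mem_univ, true_and]
    exact ⟨h ((hS' p v).2 (Or.inl hv)),
      fun u hu => h ((hS' p u).2 (Or.inr ⟨v, hv, hsymm _ _ hu⟩))⟩
  have hecard : ∀ Y : Finset (Fin n), 2 ≤ Y.card → ¬ ducPre pos Y → ¬ ducSuf pos Y →
      (e Y).card + 2 ≤ Y.card := by
    intro Y h2 h3 h4
    by_contra hcon
    have c1 : (e Y)ᶜ.card = n - (e Y).card := by rw [Finset.card_compl, Fintype.card_fin]
    have c2 : Yᶜ.card = n - Y.card := by rw [Finset.card_compl, Fintype.card_fin]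
    have c3 : Y.card ≤ n := by simpa using Finset.card_le_univ Y
    have c4 : (e Y).card ≤ n := by simpa using Finset.card_le_univ (e Y)
    have := duc_growth pos Yᶜ (e Y)ᶜ (by
      intro v
      simp only [e, Finset.mem_compl, Finset.mem_filter, Finset.mem_univ, true_and]
      constructor
      · intro h
        by_cases hv : v ∈ Y
        · right
          by_contra hc
          push Not at hc
          exact h ⟨hv, fun u hu => by
            by_contra huY
            exact hc u huY hu⟩
        · exact Or.inl hv
      · rintro (h | ⟨u, hu, huv⟩) ⟨h1, h2⟩
        · exact h h1
        · exact hu (h2 u huv)) (by omega) (by omega)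
    rcases this with h | h
    · apply h4
      intro x hx a ha
      exact h a (by simpa using ha) x (by simpa using hx)
    · apply h3
      intro x hx a ha
      exact h a (by simpa using ha) x (by simpa using hx)
  let w : ι → ℕ := fun i => (X i).card - 2 * (r + 1)
  let fa : ι → ℕ := fun i => if ducPre pos (X i) then w i else 0
  let fb : ι → ℕ := fun i => if ducSuf pos (X i) ∧ ¬ ducPre pos (X i) then w i else 0
  let a : ℕ := 2 * r + 1 + ∑ i, fa i
  let b : ℕ := 2 * r + 1 + ∑ i, fb i
  have hfa : ∀ i, fa i ≤ ∑ i, fa i := fun i =>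
    Finset.single_le_sum (fun _ _ => Nat.zero_le _) (Finset.mem_univ i)
  have hfb : ∀ i, fb i ≤ ∑ i, fb i := fun i =>
    Finset.single_le_sum (fun _ _ => Nat.zero_le _) (Finset.mem_univ i)
  let A : Finset (Fin n) := Finset.univ.filter fun v => (pos v : ℕ) < a
  let C : Finset (Fin n) := Finset.univ.filter fun v => n - 1 - (pos v : ℕ) < b
  let g : ι → Finset (Fin n) := fun i =>
    if ducPre pos (X i) ∨ ducSuf pos (X i) ∨ (X i).card ≤ 2 * (r + 1) then ∅ else e (X i)
  let X' : Option (Option ι) → Finset (Fin n) := fun o =>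
    match o with
    | none => A
    | some none => C
    | some (some i) => g i
  -- small sets
  have hsmall : ∀ p, (S' p).card ≤ 2 * (r + 1) →
      (S p).card ≤ 2 * r ∨ ∃ i, S p ⊆ X' i := by
    intro p hp
    by_cases h1 : (S p).card ≤ 2 * r
    · exact Or.inl h1
    right
    have hsub : S p ⊆ S' p := fun v hv => (hS' p v).2 (Or.inl hv)
    have hssub : S p ≠ S' p := by
      intro heq
      have := duc_closed pos (S p) (hne p) (by
        intro u hu v huv
        rw [heq]
        exact (hS' p v).2 (Or.inr ⟨u, hu, huv⟩))
      have h3 : (S p).card = n := by rw [this]; simp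
      have := Finset.card_le_card hsub
      omega
    have hlt := Finset.card_lt_card (hsub.ssubset_of_ne hssub)
    rcases duc_growth pos (S p) (S' p) (hS' p) (by omega) (by omega) with h | h
    · refine ⟨none, fun v hv => ?_⟩
      have := duc_pre_lt pos _ h v hv
      simp only [X', A, a, Finset.mem_filter, Finset.mem_univ, true_and]
      omega
    · refine ⟨some none, fun v hv => ?_⟩
      have := duc_suf_lt pos _ h v hv
      simp only [X', C, b, Finset.mem_filter, Finset.mem_univ, true_and]
      omega
  have hmain : ∀ p ∈ B, (S p).card ≤ 2 * r ∨ ∃ i, S p ⊆ X' i := by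
    intro p hp
    rcases hB p hp with h | ⟨i, hi⟩
    · exact hsmall p h
    by_cases hX : (X i).card ≤ 2 * (r + 1)
    · exact hsmall p (le_trans (Finset.card_le_card hi) hX)
    right
    have hout : ∃ z, z ∉ X i := by
      by_contra hc
      push Not at hc
      exact hU i (Finset.eq_univ_iff_forall.2 hc)
    obtain ⟨z, hz⟩ := hout
    have hin := he p _ hi
    by_cases hpre : ducPre pos (X i)
    · refine ⟨none, fun v hv => ?_⟩
      have hv' := hin hv
      simp only [e, Finset.mem_filter, Finset.mem_univ, true_and] at hv'
      have hvz := hpre v hv'.1 z hz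
      have hlt : (pos v : ℕ) + 1 < n := by have := (pos z).2; omega
      have hnext := hv'.2 (pos.symm ⟨(pos v : ℕ) + 1, hlt⟩) (Or.inr (by simp))
      have := duc_pre_lt pos _ hpre _ hnext
      simp only [Equiv.apply_symm_apply] at this
      have h5 : fa i = (X i).card - 2 * (r + 1) := by simp only [fa, w, if_pos hpre]
      have h6 := hfa i
      simp only [X', A, a, Finset.mem_filter, Finset.mem_univ, true_and]
      omega
    by_cases hsuf : ducSuf pos (X i)
    · refine ⟨some none, fun v hv => ?_⟩
      have hv' := hin hv
      simp only [e, Finset.mem_filter, Finset.mem_univ, true_and] at hv'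
      have hvz := hsuf v hv'.1 z hz
      have hlt : (pos v : ℕ) - 1 < n := by have := (pos v).2; omega
      have hnext := hv'.2 (pos.symm ⟨(pos v : ℕ) - 1, hlt⟩) (Or.inl (by simp; omega))
      have := duc_suf_lt pos _ hsuf _ hnext
      simp only [Equiv.apply_symm_apply] at this
      have h5 : fb i = (X i).card - 2 * (r + 1) := by
        simp only [fb, w, if_pos (And.intro hsuf hpre)]
      have h6 := hfb i
      have h7 := (pos v).2
      simp only [X', C, b, Finset.mem_filter, Finset.mem_univ, true_and]
      omega
    · refine ⟨some (some i), ?_⟩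
      simp only [X', g, hpre, hsuf, hX, or_self, if_false]
      exact hin
  have hfin := ih (Option (Option ι)) X' B hmain
  rw [Fintype.sum_option, Fintype.sum_option] at hfin
  have hA : A.card ≤ a := duc_card_lt pos a
  have hC : C.card ≤ b := duc_card_gt pos b
  have hsum : (∑ i, fa i) + (∑ i, fb i) + ∑ i, ((g i).card - 2 * r) ≤
      ∑ i, ((X i).card - 2 * (r + 1)) := by
    rw [← Finset.sum_add_distrib, ← Finset.sum_add_distrib]
    apply Finset.sum_le_sum
    intro i _
    by_cases hpre : ducPre pos (X i)
    · simp [fa, fb, g, w, hpre]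
    by_cases hsuf : ducSuf pos (X i)
    · simp [fa, fb, g, w, hpre, hsuf]
    by_cases hX : (X i).card ≤ 2 * (r + 1)
    · simp [fa, fb, g, w, hpre, hsuf, hX]
    · have := hecard (X i) (by omega) hpre hsuf
      simp only [fa, fb, g, hpre, hsuf, hX, or_self, if_false, false_and]
      omega
  simp only [X'] at hfin
  omega

end duc

lemma duc_pos {n : ℕ} (E : Fin n → Fin n → Prop) (h : IsUndirPath E) :
    ∃ pos : Fin n ≃ Fin n, ∀ u v, E u v ↔ ducAdj pos u v := by
  obtain ⟨σ, hσ⟩ := h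
  have hc : ∀ u v, chainEdge σ u v ↔ ((σ.symm u : Fin n) : ℕ) + 1 = (σ.symm v : Fin n) := by
    intro u v
    constructor
    · rintro ⟨i, j, hij, rfl, rfl⟩
      simp [hij]
    · intro h
      exact ⟨σ.symm u, σ.symm v, h.symm, by simp, by simp⟩
  refine ⟨σ.symm, fun u v => ?_⟩
  rw [hσ, hc, hc, ducAdj]

open Classical in
lemma duc_all {n : ℕ} (G : ℕ → Fin n → Fin n → Prop)
    (hpath : ∀ r, 1 ≤ r → IsUndirPath (G r)) (r : ℕ) :
    (∀ p, p ∈ influence G p r) ∧ ducInv (fun p => (influence G p r).toFinset) r := by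
  induction r with
  | zero =>
    refine ⟨fun p => by simp [influence], ?_⟩
    intro ι _ X B hB
    have hsub : B ⊆ Finset.univ.biUnion X := by
      intro p hp
      rcases hB p hp with h | ⟨i, hi⟩
      · have hmem : p ∈ (influence G p 0).toFinset := Set.mem_toFinset.2 rfl
        have := Finset.card_pos.2 ⟨p, hmem⟩
        simp only at h
        omega
      · simp only [Finset.mem_biUnion, Finset.mem_univ, true_and]
        exact ⟨i, hi (Set.mem_toFinset.2 rfl)⟩
    have := (Finset.card_le_card hsub).trans Finset.card_biUnion_le
    simpa using this
  | succ r ih =>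
    obtain ⟨pos, hpos⟩ := duc_pos _ (hpath (r + 1) (by omega))
    refine ⟨fun p => Or.inl (ih.1 p), ?_⟩
    refine duc_step pos _ _ r (fun p => ⟨p, by simpa using ih.1 p⟩) ?_ ih.2
    intro p v
    simp only [Set.mem_toFinset, ← hpos]
    rfl

/-- for undirected chains (paths) on `n ≥ 1` nodes,
dissemination completes within `⌈(n-1)/2⌉ = n/2` rounds. -/
theorem dissemination_undirected_chains {n : ℕ} (hn : 1 ≤ n)
    (G : ℕ → Fin n → Fin n → Prop)
    (hpath : ∀ r, 1 ≤ r → IsUndirPath (G r)) :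
    ∃ p : Fin n, influence G p (n / 2) = Set.univ := by
  classical
  have small : ∀ r, 2 * r < n → ∃ p, 2 * r + 1 ≤ (influence G p r).toFinset.card := by
    intro r hr
    by_contra hc
    push Not at hc
    have := (duc_all G hpath r).2 Empty (fun i => i.elim) Finset.univ
      (fun p _ => Or.inl (by have := hc p; simp only; omega))
    simp at this
    omega
  have full : ∀ S : Set (Fin n), n ≤ S.toFinset.card → S = Set.univ := by
    intro S h
    have := (Finset.card_eq_iff_eq_univ S.toFinset).1
      (le_antisymm (Finset.card_le_univ _) (by simpa using h))
    ext x
    have hx : x ∈ S.toFinset := by rw [this]; exact Finset.mem_univ x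
    simpa using hx
  by_cases hodd : 2 * (n / 2) < n
  · obtain ⟨p, hp⟩ := small _ hodd
    exact ⟨p, full _ (by omega)⟩
  · obtain ⟨m, hm⟩ : ∃ m, n / 2 = m + 1 := ⟨n / 2 - 1, by omega⟩
    obtain ⟨p, hp⟩ := small m (by omega)
    refine ⟨p, ?_⟩
    rw [hm]
    obtain ⟨pos, hpos⟩ := duc_pos _ (hpath (m + 1) (by omega))
    have hsub : influence G p m ⊆ influence G p (m + 1) := fun x hx => Or.inl hx
    by_cases heq : influence G p m = influence G p (m + 1)
    · have := duc_closed pos (influence G p m).toFinset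
        ⟨p, by simpa using (duc_all G hpath m).1 p⟩ (by
          intro u hu v huv
          rw [Set.mem_toFinset] at hu ⊢
          rw [heq]
          exact Or.inr ⟨u, hu, (hpos u v).2 huv⟩)
      rw [← heq]
      exact full _ (by rw [this]; simp)
    · have hlt := Finset.card_lt_card (Set.toFinset_strict_mono (hsub.ssubset_of_ne heq))
      exact full _ (by omega)
end
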